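/- arXiv:cond-mat/0004330 — 2 statements merged into one kernel-verified Lean document; each statement's English description precedes it below -/
import Mathlib

section
/- For every natural number m ≥ 3, denote by L(m) the number of non-crossing partitions of {0,1,…,m−1} in which no block contains two consecutive integers i, i+1, and by d(m) the number of non-crossing partitions of {0,1,…,m−1} in which, in addition, no block contains both 0 and m−1 (the cyclic nearest-neighbor condition). Then L(m) = d(m−1) + d(m). -/
/-- A finite partition of `{0,…,m-1}` is non-crossing if whenever `a < b < c < d` with
`a, c` in one block and `b, d` in one block, all four lie in a common block. -/
def Finpartition.IsNoncrossing {m : ℕ}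
    (P : Finpartition (Finset.univ : Finset (Fin m))) : Prop :=
  ∀ a b c d : Fin m, a < b → b < c → c < d →
    (∃ B ∈ P.parts, a ∈ B ∧ c ∈ B) → (∃ B ∈ P.parts, b ∈ B ∧ d ∈ B) →
    ∃ B ∈ P.parts, a ∈ B ∧ b ∈ B ∧ c ∈ B ∧ d ∈ B

/-- A finite partition of `{0,…,m-1}` has no (linear) nearest-neighbor pair if no block
contains two consecutive integers `i` and `i+1`. -/
def Finpartition.NoNearestNeighbor {m : ℕ}
    (P : Finpartition (Finset.univ : Finset (Fin m))) : Prop :=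
  ∀ B ∈ P.parts, ∀ i j : Fin m, (i : ℕ) + 1 = (j : ℕ) → ¬(i ∈ B ∧ j ∈ B)

/-- A finite partition of `{0,…,m-1}` has no cyclic nearest-neighbor pair if no block
contains two consecutive integers `i`, `i+1` and no block contains both `0` and `m-1`. -/
def Finpartition.NoCyclicNearestNeighbor {m : ℕ}
    (P : Finpartition (Finset.univ : Finset (Fin m))) : Prop :=
  P.NoNearestNeighbor ∧
    ∀ B ∈ P.parts, ∀ i j : Fin m, (i : ℕ) = 0 → (j : ℕ) = m - 1 → ¬(i ∈ B ∧ j ∈ B)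

/-- Two elements are related by the kernel of `P.part` iff they share a part of `P`. -/
theorem Finpartition.ker_part_iff {α : Type*} [Fintype α] [DecidableEq α]
    (P : Finpartition (Finset.univ : Finset α)) (a b : α) :
    Setoid.ker P.part a b ↔ ∃ B ∈ P.parts, a ∈ B ∧ b ∈ B := by
  rw [Setoid.ker_def, ← P.mem_part_iff_part_eq_part (Finset.mem_univ a) (Finset.mem_univ b),
    P.mem_part_iff_exists]

open Classical in
/-- Partitions of a finite type correspond to equivalence relations on it. -/
noncomputable def Finpartition.equivSetoid (α : Type*) [Fintype α] [DecidableEq α] :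
    Finpartition (Finset.univ : Finset α) ≃ Setoid α where
  toFun P := Setoid.ker P.part
  invFun s := Finpartition.ofSetoid s
  left_inv P := by
    have key : ∀ a, (Finpartition.ofSetoid (Setoid.ker P.part)).part a = P.part a := by
      intro a
      ext b
      rw [Finpartition.mem_part_ofSetoid_iff_rel, Setoid.ker_def,
        P.mem_part_iff_part_eq_part (Finset.mem_univ b) (Finset.mem_univ a), eq_comm]
    have parts_eq : ∀ Q : Finpartition (Finset.univ : Finset α), ∀ B,
        B ∈ Q.parts ↔ ∃ a, Q.part a = B := by
      intro Q B
      constructor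
      · intro hB
        obtain ⟨a, -, ha⟩ := Q.part_surjOn hB
        exact ⟨a, ha⟩
      · rintro ⟨a, rfl⟩
        exact Q.part_mem.2 (Finset.mem_univ a)
    ext B
    simp only [parts_eq, key]
  right_inv s := by
    ext a b
    rw [Setoid.ker_def, ← Finpartition.mem_part_iff_part_eq_part _ (Finset.mem_univ a)
      (Finset.mem_univ b), Finpartition.mem_part_ofSetoid_iff_rel]
    exact ⟨s.symm, s.symm⟩

/-- An equivalence relation on `Fin m` is non-crossing if crossing pairs are related. -/
def Setoid.IsNoncrossing {m : ℕ} (s : Setoid (Fin m)) : Prop :=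
  ∀ a b c d : Fin m, a < b → b < c → c < d → s a c → s b d → s a b

/-- An equivalence relation on `Fin m` relating no two consecutive integers. -/
def Setoid.NoNearestNeighbor {m : ℕ} (s : Setoid (Fin m)) : Prop :=
  ∀ i j : Fin m, (i : ℕ) + 1 = j → ¬s i j

theorem Finpartition.isNoncrossing_iff {m : ℕ} (P : Finpartition (Finset.univ : Finset (Fin m))) :
    P.IsNoncrossing ↔ (Setoid.ker P.part).IsNoncrossing := by
  simp only [Finpartition.IsNoncrossing, Setoid.IsNoncrossing, ← P.ker_part_iff]
  refine forall₄_congr fun a b c d => forall₅_congr fun _ _ _ hac hbd => ?_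
  constructor
  · rintro ⟨B, hB, ha, hb, -, -⟩
    exact (P.ker_part_iff a b).2 ⟨B, hB, ha, hb⟩
  · intro hab
    simp only [Setoid.ker_def] at hac hbd hab
    refine ⟨P.part a, P.part_mem.2 (Finset.mem_univ a), ?_, ?_, ?_, ?_⟩ <;>
      rw [P.mem_part_iff_part_eq_part (Finset.mem_univ _) (Finset.mem_univ _)]
    · exact hab.symm
    · exact hac.symm
    · exact hbd.symm.trans hab.symm

theorem Finpartition.noNearestNeighbor_iff {m : ℕ}
    (P : Finpartition (Finset.univ : Finset (Fin m))) :
    P.NoNearestNeighbor ↔ (Setoid.ker P.part).NoNearestNeighbor := by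
  simp only [Finpartition.NoNearestNeighbor, Setoid.NoNearestNeighbor, P.ker_part_iff]
  exact ⟨fun h i j hij ⟨B, hB, hb⟩ => h B hB i j hij hb,
    fun h B hB i j hij hb => h i j hij ⟨B, hB, hb⟩⟩

theorem Finpartition.noCyclicNearestNeighbor_iff {n : ℕ}
    (P : Finpartition (Finset.univ : Finset (Fin (n + 1)))) :
    P.NoCyclicNearestNeighbor ↔
      (Setoid.ker P.part).NoNearestNeighbor ∧ ¬Setoid.ker P.part 0 (Fin.last n) := by
  rw [Finpartition.NoCyclicNearestNeighbor, P.noNearestNeighbor_iff, P.ker_part_iff]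
  refine and_congr_right fun _ => ⟨?_, ?_⟩
  · rintro h ⟨B, hB, h0, hl⟩
    exact h B hB 0 (Fin.last n) rfl (by simp) ⟨h0, hl⟩
  · rintro h B hB i j hi hj ⟨hiB, hjB⟩
    obtain rfl : i = 0 := Fin.ext hi
    obtain rfl : j = Fin.last n := Fin.ext (by simpa using hj)
    exact h ⟨B, hB, hiB, hjB⟩

/-- The map `{0,…,n+1} → {0,…,n}` sending the last element to `0` and fixing all others. -/
def Fin.lastToZero (n : ℕ) : Fin (n + 2) → Fin (n + 1) :=
  Fin.lastCases 0 id

@[simp]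
theorem Fin.lastToZero_last (n : ℕ) : Fin.lastToZero n (Fin.last (n + 1)) = 0 := by
  simp [Fin.lastToZero]

@[simp]
theorem Fin.lastToZero_castSucc {n : ℕ} (i : Fin (n + 1)) :
    Fin.lastToZero n i.castSucc = i := by
  simp [Fin.lastToZero]

theorem Setoid.IsNoncrossing.comap_castSucc {n : ℕ} {s : Setoid (Fin (n + 1))}
    (h : s.IsNoncrossing) : (s.comap Fin.castSucc).IsNoncrossing :=
  fun _ _ _ _ hab hbc hcd => h _ _ _ _ hab hbc hcd

theorem Setoid.NoNearestNeighbor.comap_castSucc {n : ℕ} {s : Setoid (Fin (n + 1))}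
    (h : s.NoNearestNeighbor) : (s.comap Fin.castSucc).NoNearestNeighbor :=
  fun _ _ hij => h _ _ hij

theorem Setoid.IsNoncrossing.comap_lastToZero {n : ℕ} {s : Setoid (Fin (n + 1))}
    (h : s.IsNoncrossing) : (s.comap (Fin.lastToZero n)).IsNoncrossing := by
  intro a b c d hab hbc hcd hac hbd
  rw [Setoid.comap_rel] at hac hbd ⊢
  cases c using Fin.lastCases with
  | last => exact absurd hcd (Fin.le_last d).not_gt
  | cast c =>
    cases b using Fin.lastCases with
    | last => exact absurd hbc (Fin.le_last _).not_gt
    | cast b =>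
      cases a using Fin.lastCases with
      | last => exact absurd hab (Fin.le_last _).not_gt
      | cast a =>
        simp only [Fin.lastToZero_castSucc, Fin.castSucc_lt_castSucc_iff] at *
        cases d using Fin.lastCases with
        | last =>
          rw [Fin.lastToZero_last] at hbd
          rcases eq_or_ne a 0 with rfl | ha
          · exact s.symm hbd
          · exact s.trans (s.symm (h 0 a b c (Fin.pos_iff_ne_zero.2 ha) hab hbc
              (s.symm hbd) hac)) (s.symm hbd)
        | cast d =>
          simp only [Fin.lastToZero_castSucc, Fin.castSucc_lt_castSucc_iff] at *
          exact h a b c d hab hbc hcd hac hbd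

theorem Setoid.NoNearestNeighbor.comap_lastToZero {n : ℕ} {s : Setoid (Fin (n + 1))}
    (h : s.NoNearestNeighbor) (h0 : ¬s 0 (Fin.last n)) :
    (s.comap (Fin.lastToZero n)).NoNearestNeighbor := by
  intro i j hij hs
  rw [Setoid.comap_rel] at hs
  cases i using Fin.lastCases with
  | last => have := j.isLt; simp at hij; omega
  | cast i =>
    cases j using Fin.lastCases with
    | last =>
      obtain rfl : i = Fin.last n := Fin.ext (by simpa using hij)
      simp only [Fin.lastToZero_castSucc, Fin.lastToZero_last] at hs
      exact h0 (s.symm hs)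
    | cast j =>
      simp only [Fin.lastToZero_castSucc] at hs
      exact h i j hij hs

/-- Deleting the last point is a bijection from the non-crossing relations without neighbors
in which `0` and the last point are related, onto the cyclic ones on one point fewer. -/
def Setoid.deleteLastEquiv (n : ℕ) :
    {s : Setoid (Fin (n + 2)) //
      (s.IsNoncrossing ∧ s.NoNearestNeighbor) ∧ s 0 (Fin.last (n + 1))} ≃
    {s : Setoid (Fin (n + 1)) //
      s.IsNoncrossing ∧ s.NoNearestNeighbor ∧ ¬s 0 (Fin.last n)} where
  toFun s := ⟨s.1.comap Fin.castSucc, s.2.1.1.comap_castSucc, s.2.1.2.comap_castSucc, fun h =>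
    s.2.1.2 (Fin.last n).castSucc (Fin.last (n + 1)) (by simp) (s.1.trans (s.1.symm h) s.2.2)⟩
  invFun s := ⟨s.1.comap (Fin.lastToZero n),
    ⟨s.2.1.comap_lastToZero, s.2.2.1.comap_lastToZero s.2.2.2⟩, by
      have h0 : Fin.lastToZero n 0 = 0 := Fin.lastToZero_castSucc 0
      rw [Setoid.comap_rel, Fin.lastToZero_last, h0]⟩
  left_inv := by
    rintro ⟨s, -, h⟩
    have key : ∀ a, s (Fin.lastToZero n a).castSucc a := by
      intro a
      cases a using Fin.lastCases with
      | last => simpa using h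
      | cast a => rw [Fin.lastToZero_castSucc]
    ext a b
    exact ⟨fun hab => s.trans (s.symm (key a)) (s.trans hab (key b)),
      fun hab => s.trans (key a) (s.trans hab (s.symm (key b)))⟩
  right_inv := by
    rintro ⟨s, -⟩
    ext a b
    simp [Setoid.comap_rel]

theorem Finpartition.card_isNoncrossing_noNearestNeighbor (m : ℕ) :
    Nat.card {P : Finpartition (Finset.univ : Finset (Fin m)) //
        P.IsNoncrossing ∧ P.NoNearestNeighbor} =
      Nat.card {s : Setoid (Fin m) // s.IsNoncrossing ∧ s.NoNearestNeighbor} :=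
  Nat.card_congr <| (Finpartition.equivSetoid (Fin m)).subtypeEquiv fun P =>
    and_congr P.isNoncrossing_iff P.noNearestNeighbor_iff

theorem Finpartition.card_isNoncrossing_noCyclicNearestNeighbor (n : ℕ) :
    Nat.card {P : Finpartition (Finset.univ : Finset (Fin (n + 1))) //
        P.IsNoncrossing ∧ P.NoCyclicNearestNeighbor} =
      Nat.card {s : Setoid (Fin (n + 1)) //
        s.IsNoncrossing ∧ s.NoNearestNeighbor ∧ ¬s 0 (Fin.last n)} :=
  Nat.card_congr <| (Finpartition.equivSetoid (Fin (n + 1))).subtypeEquiv fun P =>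
    and_congr P.isNoncrossing_iff P.noCyclicNearestNeighbor_iff

/-- For `m ≥ 3`, the number `L(m)` of non-crossing non-nearest-neighbor partitions of
`{0,…,m-1}` satisfies `L(m) = d(m-1) + d(m)`, where `d` counts the non-crossing partitions
satisfying the cyclic nearest-neighbor condition. -/
theorem card_noncrossing_nnn_eq_cyclic_add_cyclic (m : ℕ) (hm : 3 ≤ m) :
    Nat.card {P : Finpartition (Finset.univ : Finset (Fin m)) //
        P.IsNoncrossing ∧ P.NoNearestNeighbor} =
      Nat.card {P : Finpartition (Finset.univ : Finset (Fin (m - 1))) //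
          P.IsNoncrossing ∧ P.NoCyclicNearestNeighbor} +
      Nat.card {P : Finpartition (Finset.univ : Finset (Fin m)) //
          P.IsNoncrossing ∧ P.NoCyclicNearestNeighbor} := by
  obtain ⟨n, rfl⟩ : ∃ n, m = n + 2 := ⟨m - 2, by omega⟩
  simp only [Nat.add_succ_sub_one]
  rw [Finpartition.card_isNoncrossing_noNearestNeighbor,
    Finpartition.card_isNoncrossing_noCyclicNearestNeighbor n,
    Finpartition.card_isNoncrossing_noCyclicNearestNeighbor (n + 1),
    ← Nat.card_congr (Setoid.deleteLastEquiv n)]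
  have : Finite (Setoid (Fin (n + 2))) :=
    Finite.of_injective (fun s : Setoid (Fin (n + 2)) => s.r) fun s t h =>
      Setoid.ext fun a b => iff_of_eq (congrFun (congrFun h a) b)
  classical
  rw [← Nat.card_sum]
  simp only [← and_assoc]
  exact Nat.card_congr <| (Equiv.sumCompl fun s : {s : Setoid (Fin (n + 2)) //
    s.IsNoncrossing ∧ s.NoNearestNeighbor} => s.1 0 (Fin.last (n + 1))).symm.trans <|
    Equiv.sumCongr (Equiv.subtypeSubtypeEquivSubtypeInter _
        fun s : Setoid (Fin (n + 2)) => s 0 (Fin.last (n + 1)))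
      (Equiv.subtypeSubtypeEquivSubtypeInter _
        fun s : Setoid (Fin (n + 2)) => ¬s 0 (Fin.last (n + 1)))
end

section
/- Define the Motzkin numbers by the explicit formula M_n = Σ_{j=0}^{⌊n/2⌋} binom(n, 2j)·C_j, where C_j is the j-th Catalan number. Then for every n ≥ 2, the Motzkin numbers satisfy the nonlinear recursion M_n = M_{n−1} + Σ_{k=0}^{n−2} M_k·M_{n−2−k}. -/
/-- The Motzkin numbers, given by the explicit formula
`M n = ∑_{j=0}^{⌊n/2⌋} (n choose 2j) · C_j`, where `C_j` is the `j`-th Catalan number. -/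
def motzkin (n : ℕ) : ℕ :=
  ∑ j ∈ Finset.range (n / 2 + 1), Nat.choose n (2 * j) * catalan j

theorem sum_antidiagonal_choose_mul_choose (m p q : ℕ) :
    ∑ x ∈ Finset.HasAntidiagonal.antidiagonal m, x.1.choose p * x.2.choose q =
      (m + 1).choose (p + q + 1) := by
  induction m generalizing q with
  | zero => cases p <;> cases q <;> simp [Nat.choose_eq_zero_of_lt]
  | succ m ih =>
    rw [Finset.Nat.sum_antidiagonal_succ']
    cases q with
    | zero =>
      have h := ih 0
      simp only [Nat.choose_zero_right, mul_one, add_zero] at h ⊢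
      rw [h, Nat.choose_succ_succ (m + 1) p]
    | succ q =>
      simp only [Nat.choose_succ_succ _ q, mul_add, Finset.sum_add_distrib, ih,
        Nat.choose_zero_succ, mul_zero, zero_add]
      exact (Nat.choose_succ_succ (m + 1) (p + q + 1)).symm

theorem motzkin_eq_sum_range {n N : ℕ} (h : n / 2 + 1 ≤ N) :
    motzkin n = ∑ j ∈ Finset.range N, n.choose (2 * j) * catalan j := by
  refine Finset.sum_subset (Finset.range_mono h) fun j _ hj => ?_
  rw [Finset.mem_range] at hj
  rw [Nat.choose_eq_zero_of_lt (by omega), zero_mul]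

theorem motzkin_mul_motzkin (k l : ℕ) :
    motzkin k * motzkin l = ∑ j ∈ Finset.range (k + l + 1),
      ∑ p ∈ Finset.HasAntidiagonal.antidiagonal j,
        k.choose (2 * p.1) * l.choose (2 * p.2) * (catalan p.1 * catalan p.2) := by
  rw [motzkin, motzkin, Finset.sum_mul_sum, ← Finset.sum_product',
    ← Finset.sum_fiberwise_of_maps_to (t := Finset.range (k + l + 1)) (g := fun p => p.1 + p.2)]
  · refine Finset.sum_congr rfl fun j _ => ?_
    simp only [mul_mul_mul_comm _ (catalan _)]
    refine Finset.sum_subset (fun p hp => ?_) fun p hp hp' => ?_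
    · simp_all
    · simp only [Finset.HasAntidiagonal.mem_antidiagonal] at hp
      simp only [Finset.mem_filter, Finset.mem_product, Finset.mem_range, hp, and_true,
        not_and_or] at hp'
      rcases hp' with h | h
      · rw [Nat.choose_eq_zero_of_lt (show k < 2 * p.1 by omega), zero_mul, zero_mul]
      · rw [Nat.choose_eq_zero_of_lt (show l < 2 * p.2 by omega), mul_zero, zero_mul]
  · intro p hp
    simp only [Finset.mem_product, Finset.mem_range] at hp ⊢
    omega

theorem sum_antidiagonal_motzkin_mul_motzkin (m : ℕ) :
    ∑ x ∈ Finset.HasAntidiagonal.antidiagonal m, motzkin x.1 * motzkin x.2 =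
      ∑ j ∈ Finset.range (m + 1), (m + 1).choose (2 * j + 1) * catalan (j + 1) := by
  have h : ∀ x ∈ Finset.HasAntidiagonal.antidiagonal m, motzkin x.1 * motzkin x.2 =
      ∑ j ∈ Finset.range (m + 1), ∑ p ∈ Finset.HasAntidiagonal.antidiagonal j,
        x.1.choose (2 * p.1) * x.2.choose (2 * p.2) * (catalan p.1 * catalan p.2) := by
    intro x hx
    rw [motzkin_mul_motzkin, Finset.HasAntidiagonal.mem_antidiagonal.mp hx]
  rw [Finset.sum_congr rfl h, Finset.sum_comm]
  refine Finset.sum_congr rfl fun j _ => ?_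
  rw [Finset.sum_comm, catalan_succ', Finset.mul_sum]
  refine Finset.sum_congr rfl fun p hp => ?_
  rw [← Finset.sum_mul, sum_antidiagonal_choose_mul_choose, ← mul_add,
    Finset.HasAntidiagonal.mem_antidiagonal.mp hp]

theorem motzkin_add_two (m : ℕ) :
    motzkin (m + 2) = motzkin (m + 1) +
      ∑ x ∈ Finset.HasAntidiagonal.antidiagonal m, motzkin x.1 * motzkin x.2 := by
  rw [sum_antidiagonal_motzkin_mul_motzkin,
    motzkin_eq_sum_range (show (m + 2) / 2 + 1 ≤ m + 1 + 1 by omega),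
    motzkin_eq_sum_range (show (m + 1) / 2 + 1 ≤ m + 1 + 1 by omega),
    Finset.sum_range_succ', Finset.sum_range_succ' _ (m + 1)]
  have h (j : ℕ) : (m + 2).choose (2 * (j + 1)) =
      (m + 1).choose (2 * j + 1) + (m + 1).choose (2 * (j + 1)) :=
    Nat.choose_succ_succ (m + 1) (2 * j + 1)
  simp only [h, add_mul, Finset.sum_add_distrib, mul_zero, Nat.choose_zero_right]
  ring

/-- The nonlinear Motzkin recursion: for `n ≥ 2`,
`M_n = M_{n-1} + ∑_{k=0}^{n-2} M_k · M_{n-2-k}`. -/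
theorem motzkin_nonlinear_recursion (n : ℕ) (hn : 2 ≤ n) :
    motzkin n = motzkin (n - 1) +
      ∑ k ∈ Finset.range (n - 1), motzkin k * motzkin (n - 2 - k) := by
  obtain ⟨m, rfl⟩ := Nat.exists_eq_add_of_le' hn
  rw [motzkin_add_two, Finset.Nat.sum_antidiagonal_eq_sum_range_succ_mk]
  rfl
end
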